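/- (Bounded occurrences of a cube in the Whitney families; Proposition on combinatorics.) Fix an integer m ≥ 1 and η ∈ (0,1). Let ω be a weight on ℝ^d, let (Ω_k)_{k∈ℤ} be a decreasing family of open sets each admitting a Whitney decomposition 𝒬_k with parameter ρ = 1 (i.e. each 𝒬_k consists of pairwise disjoint dyadic cubes with Ω_k = ⋃_{Q∈𝒬_k} Q, Q^{(1)} ⊆ Ω_k, Q^{(2)} ∩ Ω_k^c ≠ ∅ for Q ∈ 𝒬_k, plus the nested property: Q ∈ 𝒬_k, Q' ∈ 𝒬_l, Q ⊊ Q' implies k > l). For Q ∈ 𝒬_k set E_k(Q) = Q ∩ (Ω_{k+m−1} \ Ω_{k+m}), let 𝒬_k^3 ⊆ { Q ∈ 𝒬_k : ω(E_k(Q)) > η ω(Q) }, and for Q ∈ 𝒬_k let ℛ_k(Q) = { R ∈ 𝒬_{k+m} : Q^{(1)} ∩ R ≠ ∅ }. Fix a dyadic cube R and suppose (Q_1, k(1)), …, (Q_L, k(L)) are distinct pairs with Q_ℓ ∈ 𝒬_{k(ℓ)}^3 and R ∈ ℛ_{k(ℓ)}(Q_ℓ) for each ℓ. Then L ≤ C(d,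 m, η). -/

import Mathlib

open MeasureTheory ENNReal

noncomputable section

/-- Index set for dyadic cubes of `ℝ^d`: a scale `k : ℤ` and a position `n ∈ ℤ^d`. -/
abbrev DIdx (d : ℕ) : Type := ℤ × (Fin d → ℤ)

/-- The dyadic cube `∏_j [2^k n_j, 2^k (n_j + 1))` of `ℝ^d`. -/
def dcube {d : ℕ} (i : DIdx d) : Set (Fin d → ℝ) :=
  {x | ∀ j, x j ∈ Set.Ico ((2 : ℝ) ^ i.1 * (i.2 j : ℝ)) ((2 : ℝ) ^ i.1 * ((i.2 j : ℝ) + 1))}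

/-- The dyadic parent of a dyadic cube: the minimal dyadic cube strictly containing it. -/
def dparent {d : ℕ} (i : DIdx d) : DIdx d :=
  (i.1 + 1, fun j => Int.fdiv (i.2 j) 2)

/-- The measure `ω dx` on `ℝ^d` associated with a weight `ω`. -/
def wMeasure {d : ℕ} (ω : (Fin d → ℝ) → ℝ≥0∞) : Measure (Fin d → ℝ) :=
  volume.withDensity ω

/-- The average of a nonnegative function `f` over the dyadic cube indexed by `i`,
with respect to the measure `μ`. -/
def cavg {d : ℕ} (μ : Measure (Fin d → ℝ)) (i : DIdx d) (f : (Fin d → ℝ) → ℝ≥0∞) : ℝ≥0∞ :=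
  (∫⁻ x in dcube i, f x ∂μ) / μ (dcube i)

/-- Lebesgue average of a nonnegative function over a dyadic cube. -/
def lavg {d : ℕ} (i : DIdx d) (f : (Fin d → ℝ) → ℝ≥0∞) : ℝ≥0∞ :=
  cavg volume i f

/-- The `L^p` norm (real exponent `p`) of a nonnegative function with respect to `μ`. -/
def lpn {d : ℕ} (p : ℝ) (μ : Measure (Fin d → ℝ)) (f : (Fin d → ℝ) → ℝ≥0∞) : ℝ≥0∞ :=
  (∫⁻ x, f x ^ p ∂μ) ^ (1 / p)

/-- The positive dyadic operator `T_τ f = ∑_Q τ_Q (E_Q f) 1_Q`. -/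
def Tdy {d : ℕ} (τ : DIdx d → ℝ≥0∞) (f : (Fin d → ℝ) → ℝ≥0∞) (x : Fin d → ℝ) : ℝ≥0∞ :=
  ∑' i : DIdx d, (dcube i).indicator (fun _ => τ i * lavg i f) x

/-- The local part `T^in_{τ,R} f = ∑_{Q ⊆ R} τ_Q (E_Q f) 1_Q`. -/
def TdyIn {d : ℕ} (τ : DIdx d → ℝ≥0∞) (R : DIdx d) (f : (Fin d → ℝ) → ℝ≥0∞)
    (x : Fin d → ℝ) : ℝ≥0∞ :=
  ∑' i : {i : DIdx d // dcube i ⊆ dcube R},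
    (dcube i.1).indicator (fun _ => τ i.1 * lavg i.1 f) x

/-- The global part `T^out_{τ,R} f = ∑_{Q ⊇ R} τ_Q (E_Q f) 1_Q`. -/
def TdyOut {d : ℕ} (τ : DIdx d → ℝ≥0∞) (R : DIdx d) (f : (Fin d → ℝ) → ℝ≥0∞)
    (x : Fin d → ℝ) : ℝ≥0∞ :=
  ∑' i : {i : DIdx d // dcube R ⊆ dcube i},
    (dcube i.1).indicator (fun _ => τ i.1 * lavg i.1 f) x

/-- The local testing constant `⟦σ,ω⟧^Loc_{τ,p,q}
= sup_{R : ω(R)>0} ω(R)^{-1/q'} ‖T^in_{τ,R}(1_R ω)‖_{L^{p'}(σ)}`. -/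
def locTest {d : ℕ} (p q : ℝ) (τ : DIdx d → ℝ≥0∞) (σ ω : (Fin d → ℝ) → ℝ≥0∞) : ℝ≥0∞ :=
  ⨆ (R : DIdx d) (_ : wMeasure ω (dcube R) ≠ 0),
    wMeasure ω (dcube R) ^ (-(1 / (q / (q - 1)))) *
      lpn (p / (p - 1)) (wMeasure σ) (TdyIn τ R ((dcube R).indicator ω))

/-- The global testing constant `⟦σ,ω⟧^Glo_{τ,p,q}
= sup_{R : ω(R)>0} ω(R)^{-1/q'} ‖T^out_{τ,R}(1_R ω)‖_{L^{p'}(σ)}`. -/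
def gloTest {d : ℕ} (p q : ℝ) (τ : DIdx d → ℝ≥0∞) (σ ω : (Fin d → ℝ) → ℝ≥0∞) : ℝ≥0∞ :=
  ⨆ (R : DIdx d) (_ : wMeasure ω (dcube R) ≠ 0),
    wMeasure ω (dcube R) ^ (-(1 / (q / (q - 1)))) *
      lpn (p / (p - 1)) (wMeasure σ) (TdyOut τ R ((dcube R).indicator ω))

/-- The least weak-type `L^p(σ) → L^{q,∞}(ω)` constant of `f ↦ T_τ(fσ)`. -/
def weakConst {d : ℕ} (p q : ℝ) (τ : DIdx d → ℝ≥0∞) (σ ω : (Fin d → ℝ) → ℝ≥0∞) : ℝ≥0∞ :=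
  sInf {N : ℝ≥0∞ | ∀ f : (Fin d → ℝ) → ℝ≥0∞, Measurable f → lpn p (wMeasure σ) f ≠ ⊤ →
    ∀ lam : ℝ≥0∞, 0 < lam →
      wMeasure ω {x | lam < Tdy τ (fun y => f y * σ y) x} ≤
        (N * lpn p (wMeasure σ) f / lam) ^ q}


/-- The dyadic cube of scale `k` containing the point `x`. -/
def dcubeAt {d : ℕ} (k : ℤ) (x : Fin d → ℝ) : DIdx d :=
  (k, fun j => ⌊x j / (2 : ℝ) ^ k⌋)

lemma mem_dcube_iff {d : ℕ} (i : DIdx d) (x : Fin d → ℝ) : x ∈ dcube i ↔ i = dcubeAt i.1 x := by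
  have h2 : (0 : ℝ) < (2 : ℝ) ^ i.1 := by positivity
  have key : ∀ j, x j ∈ Set.Ico ((2 : ℝ) ^ i.1 * (i.2 j : ℝ)) ((2 : ℝ) ^ i.1 * ((i.2 j : ℝ) + 1)) ↔
      i.2 j = ⌊x j / (2 : ℝ) ^ i.1⌋ := by
    intro j
    rw [eq_comm, Int.floor_eq_iff, le_div_iff₀ h2, div_lt_iff₀ h2, Set.mem_Ico,
      mul_comm, mul_comm ((2 : ℝ) ^ i.1)]
  constructor
  · intro h
    exact Prod.ext rfl (funext fun j => (key j).1 (h j))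
  · intro h j
    exact (key j).2 (congrFun (congrArg Prod.snd h) j)

lemma mem_dcube_dcubeAt {d : ℕ} (k : ℤ) (x : Fin d → ℝ) : x ∈ dcube (dcubeAt k x) :=
  (mem_dcube_iff _ _).2 rfl

lemma dcube_nonempty {d : ℕ} (i : DIdx d) : (dcube i).Nonempty := by
  refine ⟨fun j => (2 : ℝ) ^ i.1 * (i.2 j : ℝ), fun j => ⟨le_rfl, ?_⟩⟩
  have h2 : (0 : ℝ) < (2 : ℝ) ^ i.1 := by positivity
  nlinarith

lemma measurableSet_dcube {d : ℕ} (i : DIdx d) : MeasurableSet (dcube i) := by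
  have : dcube i = Set.univ.pi fun j =>
      Set.Ico ((2 : ℝ) ^ i.1 * (i.2 j : ℝ)) ((2 : ℝ) ^ i.1 * ((i.2 j : ℝ) + 1)) := by
    ext x
    simp [dcube]
  rw [this]
  exact MeasurableSet.univ_pi fun _ => measurableSet_Ico

lemma dparent_dcubeAt {d : ℕ} (k : ℤ) (x : Fin d → ℝ) :
    dparent (dcubeAt k x) = dcubeAt (k + 1) x := by
  refine Prod.ext rfl (funext fun j => ?_)
  have h : x j / (2 : ℝ) ^ (k + 1) = x j / (2 : ℝ) ^ k / (2 : ℕ) := by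
    rw [zpow_add_one₀ (by norm_num), div_div]
    norm_num
  change Int.fdiv ⌊x j / (2 : ℝ) ^ k⌋ 2 = ⌊x j / (2 : ℝ) ^ (k + 1)⌋
  rw [h, Int.floor_div_natCast, Int.fdiv_eq_ediv_of_nonneg _ (by norm_num)]
  rfl

lemma dcube_subset_dparent {d : ℕ} (i : DIdx d) : dcube i ⊆ dcube (dparent i) := by
  intro x hx
  rw [(mem_dcube_iff _ _).1 hx, dparent_dcubeAt]
  exact mem_dcube_dcubeAt _ _

lemma dcube_dcubeAt_mono {d : ℕ} (x : Fin d → ℝ) {k l : ℤ} (h : k ≤ l) :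
    dcube (dcubeAt k x) ⊆ dcube (dcubeAt l x) := by
  induction l, h using Int.leInduction with
  | base => exact subset_rfl
  | succ n _ ih =>
    rw [← dparent_dcubeAt]
    exact ih.trans (dcube_subset_dparent _)

/-- The position of a dyadic cube inside its parent. -/
def dchild {d : ℕ} (i : DIdx d) : Fin d → ZMod 2 := fun j => (i.2 j : ZMod 2)

lemma eq_of_dparent_eq_of_dchild_eq {d : ℕ} {i j : DIdx d} (hp : dparent i = dparent j)
    (hc : dchild i = dchild j) : i = j := by
  have h1 : i.1 + 1 = j.1 + 1 := congrArg Prod.fst hp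
  refine Prod.ext (by omega) (funext fun t => ?_)
  have h2 : Int.fdiv (i.2 t) 2 = Int.fdiv (j.2 t) 2 := congrFun (congrArg Prod.snd hp) t
  have h3 : ((i.2 t : ℤ) : ZMod 2) = ((j.2 t : ℤ) : ZMod 2) := congrFun hc t
  rw [ZMod.intCast_eq_intCast_iff_dvd_sub] at h3
  rw [Int.fdiv_eq_ediv_of_nonneg _ (by norm_num), Int.fdiv_eq_ediv_of_nonneg _ (by norm_num)] at h2
  push_cast at h3
  omega

/-- Disjoint measurable subsets of `A`, each of measure more than `η μ(A)`, are fewer than `n` as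
soon as `n η > 1`. -/
lemma card_lt_of_mul_measure_lt {α ι : Type*} [MeasurableSpace α] (μ : Measure α) (s : Finset ι)
    (A : Set α) (E : ι → Set α) (hE : ∀ i ∈ s, MeasurableSet (E i)) (hEA : ∀ i ∈ s, E i ⊆ A)
    (hd : (s : Set ι).PairwiseDisjoint E) (η : ℝ≥0∞) (hη : 0 < η)
    (h : ∀ i ∈ s, η * μ A < μ (E i)) (n : ℕ) (hn : 1 < n * η) : s.card < n := by
  have hn0 : 0 < n := by
    rcases Nat.eq_zero_or_pos n with rfl | h0
    · simp at hn
    · exact h0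
  rcases s.eq_empty_or_nonempty with rfl | ⟨i, hi⟩
  · simpa using hn0
  have hlt : η * μ A < μ A := (h i hi).trans_le (measure_mono (hEA i hi))
  have h0 : μ A ≠ 0 := fun h0 => by simp [h0] at hlt
  have ht : μ A ≠ ⊤ := fun ht => by simp [ht, ENNReal.mul_top hη.ne'] at hlt
  have hsum : (s.card : ℝ≥0∞) * (η * μ A) ≤ μ A := by
    calc (s.card : ℝ≥0∞) * (η * μ A) = ∑ _i ∈ s, η * μ A := by simp
      _ ≤ ∑ i ∈ s, μ (E i) := Finset.sum_le_sum fun i hi => (h i hi).le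
      _ = μ (⋃ i ∈ s, E i) := (measure_biUnion_finset hd hE).symm
      _ ≤ μ A := measure_mono (Set.iUnion₂_subset hEA)
  by_contra! hc
  have h1 : (s.card : ℝ≥0∞) * η ≤ 1 := by
    rw [← mul_assoc] at hsum
    exact (ENNReal.mul_le_mul_iff_left h0 ht).1 (by simpa using hsum)
  have h2 : (n : ℝ≥0∞) * η ≤ s.card * η := by gcongr
  exact absurd (hn.trans_le (h2.trans h1)) (lt_irrefl _)

/-- **Bounded occurrences of a cube in the Whitney families.** -/
theorem stmt18 (d m : ℕ) (hm : 1 ≤ m) (η : ℝ≥0∞) (hη0 : 0 < η) (hη1 : η < 1) :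
    ∃ C : ℕ,
      ∀ ω : (Fin d → ℝ) → ℝ≥0∞, Measurable ω →
        ∀ (Ω : ℤ → Set (Fin d → ℝ)) (𝒬 Q3 : ℤ → Set (DIdx d)),
          (∀ k, IsOpen (Ω k)) →
          (∀ k, Ω (k + 1) ⊆ Ω k) →
          (∀ k, (𝒬 k).Pairwise fun i j => Disjoint (dcube i) (dcube j)) →
          (∀ k, Ω k = ⋃ i ∈ 𝒬 k, dcube i) →
          (∀ k, ∀ i ∈ 𝒬 k,
            dcube (dparent i) ⊆ Ω k ∧ (dcube (dparent (dparent i)) ∩ (Ω k)ᶜ).Nonempty) →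
          (∀ k l i j, i ∈ 𝒬 k → j ∈ 𝒬 l → dcube i ⊂ dcube j → l < k) →
          (∀ k, Q3 k ⊆ {i ∈ 𝒬 k |
            η * wMeasure ω (dcube i) <
              wMeasure ω (dcube i ∩ (Ω (k + m - 1) \ Ω (k + m)))}) →
          ∀ (R : DIdx d) (L : ℕ) (Qf : Fin L → DIdx d) (kf : Fin L → ℤ),
            Function.Injective (fun ℓ => (Qf ℓ, kf ℓ)) →
            (∀ ℓ, Qf ℓ ∈ Q3 (kf ℓ)) →
            (∀ ℓ, R ∈ 𝒬 (kf ℓ + m) ∧ (dcube (dparent (Qf ℓ)) ∩ dcube R).Nonempty) →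
            L ≤ C := by
  obtain ⟨n, hn⟩ := ENNReal.exists_nat_mul_gt hη0.ne' ENNReal.one_ne_top
  refine ⟨m * 2 ^ d + n * (2 * 2 ^ d), ?_⟩
  intro ω _ Ω 𝒬 Q3 hΩ hdec _ hcov hW _ hQ3 R L Qf kf hinj hmem hR
  have hanti : Antitone Ω := antitone_int_of_succ_le hdec
  have hQ : ∀ ℓ, Qf ℓ ∈ 𝒬 (kf ℓ) := fun ℓ => (hQ3 _ (hmem ℓ)).1
  obtain ⟨x, hx⟩ := dcube_nonempty R
  have hRx := (mem_dcube_iff _ _).1 hx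
  have hscale : ∀ ℓ, R.1 ≤ (Qf ℓ).1 + 1 := by
    intro ℓ
    by_contra! hlt
    obtain ⟨hRk, y, hyQ, hyR⟩ := hR ℓ
    obtain ⟨z, hz, hz'⟩ := (hW _ _ (hQ ℓ)).2
    refine hz' ?_
    rw [(mem_dcube_iff _ _).1 hyQ, dparent_dcubeAt] at hz
    have hz2 : z ∈ dcube R := by
      rw [(mem_dcube_iff _ _).1 hyR]
      exact dcube_dcubeAt_mono y (by change (Qf ℓ).1 + 1 + 1 ≤ R.1; omega) hz
    exact hanti (by omega) ((hW _ _ hRk).1 (dcube_subset_dparent _ hz2))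
  have hpar : ∀ ℓ, dparent (Qf ℓ) = dcubeAt ((Qf ℓ).1 + 1) x := by
    intro ℓ
    obtain ⟨-, y, hyQ, hyR⟩ := hR ℓ
    refine (mem_dcube_iff _ _).1 ?_
    rw [(mem_dcube_iff _ _).1 hyR] at hx
    rw [(mem_dcube_iff _ _).1 hyQ]
    exact dcube_dcubeAt_mono y (hscale ℓ) hx
  have heq : ∀ ℓ ℓ', (Qf ℓ).1 = (Qf ℓ').1 → dchild (Qf ℓ) = dchild (Qf ℓ') → Qf ℓ = Qf ℓ' :=
    fun ℓ ℓ' h1 h2 => eq_of_dparent_eq_of_dchild_eq (by rw [hpar, hpar, h1]) h2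
  have hlevel : ∀ ℓ ℓ', kf ℓ = kf ℓ' → (Qf ℓ').1 ≤ (Qf ℓ).1 := by
    intro ℓ ℓ' hk
    by_contra! hlt
    obtain ⟨z, hz, hz'⟩ := (hW _ _ (hQ ℓ)).2
    refine hz' ?_
    rw [hpar, dparent_dcubeAt] at hz
    rw [hk]
    refine (hW _ _ (hQ ℓ')).1 ?_
    rw [hpar]
    exact dcube_dcubeAt_mono x (by omega) hz
  have hlarge : ∀ ℓ ℓ', kf ℓ' + m ≤ kf ℓ → (Qf ℓ).1 ≤ R.1 := by
    intro ℓ ℓ' hk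
    by_contra! hlt
    obtain ⟨z, hz, hz'⟩ := (hW _ _ (hR ℓ').1).2
    refine hz' (hanti hk ((hW _ _ (hQ ℓ)).1 ?_))
    rw [hRx, dparent_dcubeAt, dparent_dcubeAt] at hz
    rw [hpar]
    exact dcube_dcubeAt_mono x (by omega) hz
  rcases Nat.eq_zero_or_pos L with rfl | hL
  · exact Nat.zero_le _
  have : Nonempty (Fin L) := ⟨⟨0, hL⟩⟩
  obtain ⟨ℓ₀, hℓ₀⟩ := Finite.exists_min kf
  have hcardZ : Fintype.card (Fin d → ZMod 2) = 2 ^ d := by simp [ZMod.card]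
  have hlow : (Finset.univ.filter fun ℓ => kf ℓ < kf ℓ₀ + m).card ≤ m * 2 ^ d := by
    have := Finset.card_le_card_of_injOn
      (s := Finset.univ.filter fun ℓ => kf ℓ < kf ℓ₀ + m)
      (t := Finset.Ico (kf ℓ₀) (kf ℓ₀ + m) ×ˢ (Finset.univ : Finset (Fin d → ZMod 2)))
      (fun ℓ => (kf ℓ, dchild (Qf ℓ)))
      (fun ℓ hℓ => by simpa [hℓ₀ ℓ] using hℓ)
      (by
        intro ℓ _ ℓ' _ h
        obtain ⟨h1, h2⟩ := Prod.mk.inj h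
        have h3 := le_antisymm (hlevel _ _ h1.symm) (hlevel _ _ h1)
        exact hinj (Prod.ext (heq _ _ h3 h2) h1))
    rwa [Finset.card_product, Int.card_Ico, Finset.card_univ, hcardZ, add_sub_cancel_left,
      Int.toNat_natCast] at this
  have hhigh : (Finset.univ.filter fun ℓ => ¬ kf ℓ < kf ℓ₀ + m).card ≤ n * (2 * 2 ^ d) := by
    have := Finset.card_le_mul_card_image_of_maps_to
      (s := Finset.univ.filter fun ℓ => ¬ kf ℓ < kf ℓ₀ + m)
      (t := Finset.Icc (R.1 - 1) R.1 ×ˢ (Finset.univ : Finset (Fin d → ZMod 2)))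
      (f := fun ℓ => ((Qf ℓ).1, dchild (Qf ℓ)))
      (fun ℓ hℓ => by
        have h1 := hscale ℓ
        have h2 := hlarge ℓ ℓ₀ (by simpa using hℓ)
        simp only [Finset.mem_product, Finset.mem_Icc, Finset.mem_univ, and_true]
        omega) n
      (by
        intro b _
        rcases Finset.eq_empty_or_nonempty
          ((Finset.univ.filter fun ℓ => ¬ kf ℓ < kf ℓ₀ + m).filter
            fun ℓ => ((Qf ℓ).1, dchild (Qf ℓ)) = b) with he | ⟨ℓ₁, hℓ₁⟩
        · rw [he]
          exact Nat.zero_le _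
        have hconst : ∀ ℓ ∈ (Finset.univ.filter fun ℓ => ¬ kf ℓ < kf ℓ₀ + m).filter
            fun ℓ => ((Qf ℓ).1, dchild (Qf ℓ)) = b, Qf ℓ = Qf ℓ₁ := by
          intro ℓ hℓ
          obtain ⟨h1, h2⟩ := Prod.mk.inj
            ((Finset.mem_filter.1 hℓ).2.trans (Finset.mem_filter.1 hℓ₁).2.symm)
          exact heq _ _ h1 h2
        refine (card_lt_of_mul_measure_lt (wMeasure ω) _ (dcube (Qf ℓ₁))
          (fun ℓ => dcube (Qf ℓ₁) ∩ (Ω (kf ℓ + m - 1) \ Ω (kf ℓ + m))) ?_ ?_ ?_ η hη0 ?_ n hn).le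
        · exact fun ℓ _ => (measurableSet_dcube _).inter
            ((hΩ _).measurableSet.diff (hΩ _).measurableSet)
        · exact fun ℓ _ => Set.inter_subset_left
        · intro ℓ hℓ ℓ' hℓ' hne
          have hk : kf ℓ ≠ kf ℓ' := fun hk =>
            hne (hinj (Prod.ext ((hconst ℓ hℓ).trans (hconst ℓ' hℓ').symm) hk))
          refine Set.disjoint_left.2 ?_
          rintro y ⟨-, hy1, hy2⟩ ⟨-, hy3, hy4⟩
          rcases lt_or_gt_of_ne hk with hk | hk
          · exact hy2 (hanti (by omega) hy3)
          · exact hy4 (hanti (by omega) hy1)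
        · intro ℓ hℓ
          have := (hQ3 _ (hmem ℓ)).2
          rwa [hconst ℓ hℓ] at this)
    rw [Finset.card_product, Int.card_Icc, Finset.card_univ, hcardZ] at this
    rwa [show (R.1 + 1 - (R.1 - 1)).toNat = 2 by omega] at this
  have hsplit := Finset.card_filter_add_card_filter_not
    (s := (Finset.univ : Finset (Fin L))) (fun ℓ => kf ℓ < kf ℓ₀ + m)
  rw [Finset.card_univ, Fintype.card_fin] at hsplit
  omega
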